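/- For every prime p ≥ 5, every integer k ≥ 1, and all nonnegative integers n, m, n₀, m₀ with n₀ < p and m₀ < p, the binomial coefficient C(n·p^k + n₀, m·p^k + m₀) is congruent to C(n·p^⌊(k−1)/3⌋, m·p^⌊(k−1)/3⌋)·C(n₀, m₀) modulo p^k. -/

import Mathlib

open Finset in
/-- Separating the multiples of `p` in a product of `p * b` consecutive integers. -/
theorem prod_range_mul_succ_eq (p x b : ℕ) (hp : 0 < p) :
    ∏ i ∈ range (p * b), (p * x + 1 + i) =
      p ^ b * (∏ l ∈ range b, (x + 1 + l)) *
        ∏ i ∈ range (p * b) with ¬ p ∣ i, (p * x + i) := by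
  simp only [prod_filter]
  induction b with
  | zero => simp
  | succ b ih =>
    have key : ∏ r ∈ range p, (p * x + 1 + (p * b + r)) =
        (p * (x + 1 + b)) *
          ∏ r ∈ range p, if ¬ p ∣ p * b + r then p * x + (p * b + r) else 1 := by
      obtain ⟨d, rfl⟩ : ∃ d, p = d + 1 := ⟨p - 1, by omega⟩
      rw [prod_range_succ, prod_range_succ' _ d]
      have h : ∀ r ∈ range d, (if ¬ (d + 1) ∣ (d + 1) * b + (r + 1) then
          (d + 1) * x + ((d + 1) * b + (r + 1)) else 1) =
          (d + 1) * x + 1 + ((d + 1) * b + r) := by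
        intro r hr
        rw [if_pos]
        · ring
        · rw [Nat.dvd_add_right (Dvd.intro _ rfl)]
          exact Nat.not_dvd_of_pos_of_lt (by omega) (by simpa using hr)
      rw [prod_congr rfl h]
      simp
      ring
    rw [mul_add_one, prod_range_succ _ b, prod_range_add, prod_range_add, ih, key]
    ring

open Finset in
theorem factorial_mul_eq (p b : ℕ) (hp : 0 < p) :
    (p * b).factorial =
      p ^ b * b.factorial * ∏ i ∈ range (p * b) with ¬ p ∣ i, i := by
  have h := prod_range_mul_succ_eq p 0 b hp
  simp only [mul_zero, zero_add] at h
  rw [← prod_range_add_one_eq_factorial, ← prod_range_add_one_eq_factorial]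
  simpa only [add_comm] using h

open Finset in
theorem choose_mul_prod_eq (p x b : ℕ) (hp : 0 < p) :
    (p * x + p * b).choose (p * b) * ∏ i ∈ range (p * b) with ¬ p ∣ i, i =
      (x + b).choose b * ∏ i ∈ range (p * b) with ¬ p ∣ i, (p * x + i) := by
  have h := prod_range_mul_succ_eq p x b hp
  rw [← Nat.ascFactorial_eq_prod_range, ← Nat.ascFactorial_eq_prod_range,
    Nat.ascFactorial_eq_factorial_mul_choose, Nat.ascFactorial_eq_factorial_mul_choose,
    factorial_mul_eq p b hp] at h
  have h0 : 0 < p ^ b * b.factorial := by positivity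
  refine Nat.eq_of_mul_eq_mul_left h0 ?_
  linarith

open Finset in
/-- First order expansion of a product of perturbed units. -/
theorem prod_add_eq_of_sq_eq_zero {ι R : Type*} [CommRing R] (s : Finset ι) (f : ι → R)
    (hf : ∀ i ∈ s, IsUnit (f i)) (y : R) (hy : y ^ 2 = 0) :
    ∏ i ∈ s, (y + f i) = (∏ i ∈ s, f i) * (1 + y * ∑ i ∈ s, Ring.inverse (f i)) := by
  classical
  induction s using Finset.induction_on with
  | empty => simp
  | insert a s ha ih =>
    rw [prod_insert ha, prod_insert ha, sum_insert ha,
      ih fun i hi => hf i (mem_insert_of_mem hi)]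
    have h := Ring.mul_inverse_cancel _ (hf a (mem_insert_self a s))
    linear_combination (∏ i ∈ s, f i) * (∑ i ∈ s, Ring.inverse (f i)) * hy
      - y * (∏ i ∈ s, f i) * h

open Finset in
theorem sum_range_mul_zmod {M : Type*} [AddCommMonoid M] (q b : ℕ) [NeZero q]
    (g : ZMod q → M) :
    ∑ i ∈ range (q * b), g (i : ZMod q) = b • ∑ x : ZMod q, g x := by
  have h : ∑ i ∈ range q, g (i : ZMod q) = ∑ x : ZMod q, g x :=
    sum_nbij' (fun i => (i : ZMod q)) ZMod.val (by simp) (by simp [ZMod.val_lt])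
      (fun i hi => ZMod.val_cast_of_lt (by simpa using hi)) (by simp) (by simp)
  induction b with
  | zero => simp
  | succ b ih =>
    rw [mul_add_one, sum_range_add, ih, add_smul, one_smul]
    simp [h]

theorem sum_inverse_sq_eq_zero {R : Type*} [CommRing R] [Fintype R]
    (h2 : IsUnit (2 : R)) (h3 : IsUnit (3 : R)) :
    ∑ x : R, Ring.inverse x ^ 2 = 0 := by
  have h := Fintype.sum_equiv (Units.mulLeft h2.unit) (fun x => Ring.inverse (2 * x) ^ 2)
    (fun x => Ring.inverse x ^ 2) (fun x => by simp)
  simp only [Ring.mul_inverse_rev, mul_pow, ← Finset.sum_mul] at h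
  have h' := Ring.mul_inverse_cancel _ h2
  refine h3.mul_right_eq_zero.mp ?_
  linear_combination -4 * h + (∑ x : R, Ring.inverse x ^ 2) * (2 * Ring.inverse 2 + 1) * h'

theorem map_ringInverse_of_isUnit {R S : Type*} [Ring R] [Ring S] (f : R →+* S) {x : R}
    (hx : IsUnit x) : f (Ring.inverse x) = Ring.inverse (f x) := by
  obtain ⟨u, rfl⟩ := hx
  have := Ring.inverse_unit (Units.map (f : R →* S) u)
  simp_all

theorem ringInverse_neg {R : Type*} [CommRing R] (x : R) :
    Ring.inverse (-x) = -Ring.inverse x := by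
  have h : Ring.inverse (-1 : R) = -1 := by simpa using Ring.inverse_unit (-1 : Rˣ)
  rw [← neg_one_mul, Ring.mul_inverse_rev, h, mul_neg_one]

theorem isUnit_natCast_zmod_prime_pow {p : ℕ} (hp : p.Prime) {t i : ℕ} (ht : t ≠ 0) :
    IsUnit (i : ZMod (p ^ t)) ↔ ¬ p ∣ i := by
  rw [ZMod.isUnit_iff_coprime, Nat.coprime_pow_right_iff (Nat.pos_of_ne_zero ht),
    Nat.coprime_comm, hp.coprime_iff_not_dvd]

open Finset in
theorem sum_inverse_sq_filter_eq_zero {p : ℕ} (hp : p.Prime) (hp5 : 5 ≤ p) {t B : ℕ}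
    (ht : t ≠ 0) (hB : p ^ t ∣ B) :
    ∑ i ∈ range B with ¬ p ∣ i, Ring.inverse (i : ZMod (p ^ t)) ^ 2 = 0 := by
  have : NeZero (p ^ t) := ⟨pow_ne_zero _ hp.ne_zero⟩
  obtain ⟨b, rfl⟩ := hB
  have h2 : IsUnit (2 : ZMod (p ^ t)) := by
    exact_mod_cast (isUnit_natCast_zmod_prime_pow hp (i := 2) ht).2
      (Nat.not_dvd_of_pos_of_lt (by norm_num) (by omega))
  have h3 : IsUnit (3 : ZMod (p ^ t)) := by
    exact_mod_cast (isUnit_natCast_zmod_prime_pow hp (i := 3) ht).2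
      (Nat.not_dvd_of_pos_of_lt (by norm_num) (by omega))
  rw [sum_filter_of_ne, sum_range_mul_zmod (p ^ t) b (fun x => Ring.inverse x ^ 2),
    sum_inverse_sq_eq_zero h2 h3, smul_zero]
  intro i _ hi
  rw [← isUnit_natCast_zmod_prime_pow hp ht]
  by_contra h
  exact hi (by simp [Ring.inverse_non_unit _ h])

open Finset in
theorem prod_reflect_filter_not_dvd {M : Type*} [CommMonoid M] {p B : ℕ} (hB : p ∣ B)
    (f : ℕ → M) :
    ∏ i ∈ range B with ¬ p ∣ i, f (B - i) = ∏ i ∈ range B with ¬ p ∣ i, f i := by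
  have h : ∀ i ∈ (range B).filter (¬ p ∣ ·), B - i ∈ (range B).filter (¬ p ∣ ·) := by
    intro i hi
    simp only [mem_filter, mem_range] at hi ⊢
    have : i ≠ 0 := by rintro rfl; simp at hi
    refine ⟨by omega, fun h => hi.2 ?_⟩
    rwa [Nat.dvd_sub_iff_right hi.1.le hB] at h
  refine prod_nbij' (B - ·) (B - ·) h h ?_ ?_ (fun _ _ => rfl) <;>
  · intro i hi
    simp only [mem_filter, mem_range] at hi
    exact Nat.sub_sub_self hi.1.le

open Finset in
theorem prod_add_sq_eq {p : ℕ} (hp : p.Prime) (hp5 : 5 ≤ p) {t B c : ℕ}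
    (ht : t ≠ 0) (hB : p ^ t ∣ B) (hc : p ^ t ∣ c) :
    (∏ i ∈ range B with ¬ p ∣ i, ((c : ZMod (p ^ (3 * t))) + i)) ^ 2 =
      (∏ i ∈ range B with ¬ p ∣ i, (i : ZMod (p ^ (3 * t)))) ^ 2 := by
  have hpB : p ∣ B := (dvd_pow_self p ht).trans hB
  have ht3 : 3 * t ≠ 0 := by omega
  set s := (range B).filter (¬ p ∣ ·) with hs
  have hlt : ∀ i ∈ s, i ≤ B ∧ ¬ p ∣ i := by
    intro i hi
    simp only [hs, mem_filter, mem_range] at hi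
    exact ⟨hi.1.le, hi.2⟩
  have pair : ∀ e : ℕ, (∏ i ∈ s, ((e : ZMod (p ^ (3 * t))) + i)) ^ 2 =
      ∏ i ∈ s, ((e : ZMod (p ^ (3 * t))) * (e + B) + i * (B - i)) := by
    intro e
    have hrefl := prod_reflect_filter_not_dvd hpB fun i => (e : ZMod (p ^ (3 * t))) + i
    rw [← hs] at hrefl
    rw [sq]
    nth_rewrite 2 [← hrefl]
    rw [← prod_mul_distrib]
    refine prod_congr rfl fun i hi => ?_
    rw [Nat.cast_sub (hlt i hi).1]
    ring
  have hq3 : ((p : ZMod (p ^ (3 * t))) ^ t) ^ 3 = 0 := by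
    rw [← pow_mul, mul_comm t 3]
    exact_mod_cast ZMod.natCast_self (p ^ (3 * t))
  have hunit : ∀ i ∈ s, IsUnit ((i : ZMod (p ^ (3 * t))) * (B - i)) := by
    intro i hi
    obtain ⟨h1, h2⟩ := hlt i hi
    refine IsUnit.mul ((isUnit_natCast_zmod_prime_pow hp ht3).2 h2) ?_
    rw [← Nat.cast_sub h1, isUnit_natCast_zmod_prime_pow hp ht3]
    rwa [Nat.dvd_sub_iff_right h1 hpB]
  obtain ⟨b, hb⟩ := hB
  obtain ⟨d, hd⟩ := hc
  have hy : (c : ZMod (p ^ (3 * t))) * (c + B) = ((p : ZMod (p ^ (3 * t))) ^ t) ^ 2 *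
      (d * (d + b)) := by
    rw [hb, hd]; push_cast; ring
  have hsum : (p ^ t : ℕ) ∣ (∑ i ∈ s, Ring.inverse ((i : ZMod (p ^ (3 * t))) * (B - i))).val := by
    rw [← ZMod.natCast_eq_zero_iff]
    have hdvd : p ^ t ∣ p ^ (3 * t) := pow_dvd_pow _ (by omega)
    have : NeZero (p ^ (3 * t)) := ⟨pow_ne_zero _ hp.ne_zero⟩
    rw [ZMod.natCast_val, ← ZMod.castHom_apply (h := hdvd), map_sum]
    have hB0 : (B : ZMod (p ^ t)) = 0 := (ZMod.natCast_eq_zero_iff _ _).2 ⟨b, hb⟩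
    have : ∀ i ∈ s, ZMod.castHom hdvd (ZMod (p ^ t))
        (Ring.inverse ((i : ZMod (p ^ (3 * t))) * (B - i))) =
        - Ring.inverse (i : ZMod (p ^ t)) ^ 2 := by
      intro i hi
      rw [map_ringInverse_of_isUnit _ (hunit i hi)]
      simp only [map_mul, map_sub, map_natCast, hB0, zero_sub]
      rw [Ring.mul_inverse_rev, ringInverse_neg]
      ring
    rw [sum_congr rfl this, sum_neg_distrib, hs,
      sum_inverse_sq_filter_eq_zero hp hp5 ht ⟨b, hb⟩, neg_zero]
  obtain ⟨w, hw⟩ := hsum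
  have hw' : ∑ i ∈ s, Ring.inverse ((i : ZMod (p ^ (3 * t))) * (B - i)) =
      (p : ZMod (p ^ (3 * t))) ^ t * w := by
    have : NeZero (p ^ (3 * t)) := ⟨pow_ne_zero _ hp.ne_zero⟩
    rw [← ZMod.natCast_zmod_val (∑ i ∈ s, _), hw]
    push_cast
    rfl
  have h0 := pair 0
  simp only [Nat.cast_zero, zero_add, zero_mul] at h0
  rw [pair c, h0, prod_add_eq_of_sq_eq_zero s _ hunit, hw', hy]
  · linear_combination (∏ i ∈ s, (i : ZMod (p ^ (3 * t))) * (B - i)) * (d * (d + b)) * w * hq3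
  · rw [hy]
    linear_combination (p : ZMod (p ^ (3 * t))) ^ t * (d * (d + b)) ^ 2 * hq3

open Finset in
theorem prod_add_eq {p : ℕ} (hp : p.Prime) (hp5 : 5 ≤ p) {t B c : ℕ}
    (ht : t ≠ 0) (hB : p ^ t ∣ B) (hc : p ^ t ∣ c) :
    ∏ i ∈ range B with ¬ p ∣ i, ((c : ZMod (p ^ (3 * t))) + i) =
      ∏ i ∈ range B with ¬ p ∣ i, (i : ZMod (p ^ (3 * t))) := by
  have hsq := prod_add_sq_eq hp hp5 ht hB hc
  have hmod : ∏ i ∈ range B with ¬ p ∣ i, (c + i) ≡ ∏ i ∈ range B with ¬ p ∣ i, i [MOD p] := by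
    refine Nat.ModEq.prod fun i _ => ?_
    have : c ≡ 0 [MOD p] := Nat.modEq_zero_iff_dvd.2 ((dvd_pow_self p ht).trans hc)
    simpa using this.add_right i
  have hunit : IsUnit (∏ i ∈ range B with ¬ p ∣ i, ((c : ZMod (p ^ (3 * t))) + i) +
      ∏ i ∈ range B with ¬ p ∣ i, (i : ZMod (p ^ (3 * t)))) := by
    have : IsUnit ((∏ i ∈ range B with ¬ p ∣ i, (c + i) +
        ∏ i ∈ range B with ¬ p ∣ i, i : ℕ) : ZMod (p ^ (3 * t))) := by
      rw [isUnit_natCast_zmod_prime_pow hp (by omega)]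
      intro h
      rw [(hmod.add_right _).dvd_iff dvd_rfl, ← two_mul, hp.dvd_mul,
        hp.prime.dvd_finsetProd_iff] at h
      rcases h with h | ⟨i, hi, h⟩
      · exact absurd (Nat.le_of_dvd two_pos h) (by omega)
      · exact (mem_filter.1 hi).2 h
    simpa only [Nat.cast_add, Nat.cast_prod] using this
  rw [← sub_eq_zero, ← hunit.mul_right_eq_zero]
  linear_combination hsq

/-- **Jacobsthal's congruence**. -/
theorem choose_mul_modEq_choose {p : ℕ} (hp : p.Prime) (hp5 : 5 ≤ p) {j a b : ℕ}
    (ha : p ^ j ∣ a) (hb : p ^ j ∣ b) :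
    (p * a).choose (p * b) ≡ a.choose b [MOD p ^ (3 * (j + 1))] := by
  rcases lt_or_ge a b with hab | hab
  · rw [Nat.choose_eq_zero_of_lt hab, Nat.choose_eq_zero_of_lt]
    exact Nat.mul_lt_mul_of_pos_left hab hp.pos
  obtain ⟨x, rfl⟩ := Nat.exists_eq_add_of_le' hab
  have hx : p ^ j ∣ x := (Nat.dvd_add_left hb).1 ha
  have h := congrArg (Nat.cast : ℕ → ZMod (p ^ (3 * (j + 1)))) (choose_mul_prod_eq p x b hp.pos)
  have hP := prod_add_eq hp hp5 j.succ_ne_zero (B := p * b) (c := p * x)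
    (by rw [pow_succ']; exact mul_dvd_mul_left p hb) (by rw [pow_succ']; exact mul_dvd_mul_left p hx)
  push_cast at h hP
  rw [hP] at h
  rw [mul_add p, ← ZMod.natCast_eq_natCast_iff]
  refine IsUnit.mul_right_cancel ?_ h
  rw [IsUnit.prod_iff]
  intro i hi
  exact (isUnit_natCast_zmod_prime_pow hp (by omega)).2 (Finset.mem_filter.1 hi).2

theorem choose_mul_pow_modEq {p : ℕ} (hp : p.Prime) (hp5 : 5 ≤ p) (n m j d : ℕ) :
    (n * p ^ (j + d)).choose (m * p ^ (j + d)) ≡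
      (n * p ^ j).choose (m * p ^ j) [MOD p ^ (3 * (j + 1))] := by
  induction d with
  | zero => rfl
  | succ d ih =>
    have hd : p ^ j ∣ p ^ (j + d) := pow_dvd_pow p (by omega)
    have h := choose_mul_modEq_choose hp hp5 (hd.mul_left n) (hd.mul_left m)
    rw [mul_left_comm, mul_left_comm p m, ← pow_succ'] at h
    exact h.trans ih

theorem prime_pow_dvd_choose {p : ℕ} (hp : p.Prime) {k N r : ℕ} (hN : p ^ k ∣ N)
    (hr : ¬ p ∣ r) : p ^ k ∣ N.choose r := by
  rcases N with _ | N
  · rcases r with _ | r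
    · simp at hr
    · simp
  · rcases r with _ | r
    · simp at hr
    refine Nat.Coprime.dvd_of_dvd_mul_right (n := r + 1)
      (Nat.Coprime.pow_left k ((hp.coprime_iff_not_dvd).2 hr)) ?_
    rw [← Nat.add_one_mul_choose_eq]
    exact hN.mul_right _

theorem choose_add_modEq {p : ℕ} (hp : p.Prime) {k N M n0 m0 : ℕ} (hk : k ≠ 0)
    (hN : p ^ k ∣ N) (hM : p ^ k ∣ M) (hn0 : n0 < p) (hm0 : m0 < p) :
    (N + n0).choose (M + m0) ≡ N.choose M * n0.choose m0 [MOD p ^ k] := by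
  rw [← ZMod.natCast_eq_natCast_iff, Nat.add_choose_eq, Nat.cast_sum,
    Finset.sum_eq_single (M, m0)]
  · rintro ⟨r, s⟩ hrs hne
    replace hrs : r + s = M + m0 := by simpa using hrs
    dsimp only
    rw [ZMod.natCast_eq_zero_iff]
    rcases lt_or_ge n0 s with hs | hs
    · simp [Nat.choose_eq_zero_of_lt hs]
    refine (prime_pow_dvd_choose hp hN fun hr => hne ?_).mul_right _
    have hpM : p ∣ M := (dvd_pow_self p hk).trans hM
    have hmod : s ≡ m0 [MOD p] := by
      have h : r + s ≡ M + m0 [MOD p] := by rw [hrs]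
      exact Nat.ModEq.add_left_cancel
        ((Nat.modEq_zero_iff_dvd.2 hr).trans (Nat.modEq_zero_iff_dvd.2 hpM).symm) h
    have hsm := hmod.eq_of_lt_of_lt (hs.trans_lt hn0) hm0
    subst hsm
    exact Prod.ext (by simpa using hrs) rfl
  · simp

theorem stmt8 (p : ℕ) (hp : p.Prime) (hp5 : 5 ≤ p) (k n m n0 m0 : ℕ) (hk : 1 ≤ k)
    (hn0 : n0 < p) (hm0 : m0 < p) :
    (n * p ^ k + n0).choose (m * p ^ k + m0) ≡
      (n * p ^ ((k - 1) / 3)).choose (m * p ^ ((k - 1) / 3)) * n0.choose m0 [MOD p ^ k] := by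
  refine (choose_add_modEq hp (by omega) (Dvd.intro_left n rfl) (Dvd.intro_left m rfl)
    hn0 hm0).trans (Nat.ModEq.mul_right _ ?_)
  obtain ⟨d, hd⟩ : ∃ d, k = (k - 1) / 3 + d := ⟨k - (k - 1) / 3, by omega⟩
  have h := choose_mul_pow_modEq hp hp5 n m ((k - 1) / 3) d
  rw [← hd] at h
  exact h.of_dvd (pow_dvd_pow p (by omega))
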